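/- For ideal MHD with γ-law gas, the entropy flux gradient satisfies the compatibility relation ∂F₁/∂w = v(w)ᵀ (∂f₁/∂w) + φ(v(w)) (∂B₁/∂w), where v is the entropy variable and φ(v) = 2β(u·B). -/

import Mathlib

/-- Quotient rule for Fréchet derivatives of real-valued functions. -/
theorem hasFDerivAt_div_real {E : Type*} [NormedAddCommGroup E] [NormedSpace ℝ E]
    {f g : E → ℝ} {f' g' : E →L[ℝ] ℝ} {x : E} (hf : HasFDerivAt f f' x)
    (hg : HasFDerivAt g g' x) (hx : g x ≠ 0) :
    HasFDerivAt (fun z => f z / g z) ((g x)⁻¹ • f' - (f x / g x ^ 2) • g') x := by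
  have h := hf.fun_mul ((hasDerivAt_inv hx).comp_hasFDerivAt x hg)
  simp only [Function.comp_def, ← div_eq_mul_inv] at h
  refine h.congr_fderiv ?_
  ext v
  simp
  ring

/-- The derivative of `log (p ρ ^ (-γ))` is `dp / p - γ dρ / ρ`. -/
theorem hasFDerivAt_log_mul_rpow_neg {E : Type*} [NormedAddCommGroup E] [NormedSpace ℝ E]
    {p ρ : E → ℝ} {p' ρ' : E →L[ℝ] ℝ} {x : E} (γ : ℝ) (hp : HasFDerivAt p p' x)
    (hρ : HasFDerivAt ρ ρ' x) (hpx : 0 < p x) (hρx : 0 < ρ x) :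
    HasFDerivAt (fun z => Real.log (p z * ρ z ^ (-γ))) ((p x)⁻¹ • p' - (γ / ρ x) • ρ') x := by
  have hpow : 0 < ρ x ^ (-γ) := Real.rpow_pos_of_pos hρx _
  have h := (hp.fun_mul (hρ.rpow_const (p := -γ) (Or.inl hρx.ne'))).log (mul_pos hpx hpow).ne'
  refine h.congr_fderiv ?_
  ext v
  simp [Real.rpow_sub_one hρx.ne']
  field_simp
  ring

/-- For ideal MHD with γ-law gas, the entropy flux gradient satisfies the
compatibility relation ∂F₁/∂w = vᵀ ∂f₁/∂w + φ(v) ∂B₁/∂w on the admissible set. -/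
theorem mhd_entropy_flux_compatibility (γ : ℝ) (hγ : 1 < γ)
    (pfun sfun βfun F1 φ : (Fin 8 → ℝ) → ℝ)
    (f1 vv : (Fin 8 → ℝ) → Fin 8 → ℝ)
    (hp : ∀ w, pfun w = (γ - 1) * (w 7 - (w 1 ^ 2 + w 2 ^ 2 + w 3 ^ 2) / (2 * w 0)
        - (w 4 ^ 2 + w 5 ^ 2 + w 6 ^ 2) / 2))
    (hs : ∀ w, sfun w = Real.log (pfun w * (w 0) ^ (-γ)))
    (hβ : ∀ w, βfun w = w 0 / (2 * pfun w))
    (hF1 : ∀ w, F1 w = -(w 1 * sfun w) / (γ - 1))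
    (hf1 : ∀ w,
      f1 w 0 = w 1 ∧
      f1 w 1 = w 1 * w 1 / w 0 - w 4 * w 4
        + (pfun w + (w 4 ^ 2 + w 5 ^ 2 + w 6 ^ 2) / 2) ∧
      f1 w 2 = w 1 * w 2 / w 0 - w 4 * w 5 ∧
      f1 w 3 = w 1 * w 3 / w 0 - w 4 * w 6 ∧
      f1 w 4 = 0 ∧
      f1 w 5 = (w 1 / w 0) * w 5 - w 4 * (w 2 / w 0) ∧
      f1 w 6 = (w 1 / w 0) * w 6 - w 4 * (w 3 / w 0) ∧
      f1 w 7 = (w 7 + pfun w + (w 4 ^ 2 + w 5 ^ 2 + w 6 ^ 2) / 2) * (w 1 / w 0)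
        - ((w 1 * w 4 + w 2 * w 5 + w 3 * w 6) / w 0) * w 4)
    (hv : ∀ w,
      vv w 0 = (γ - sfun w) / (γ - 1)
        - βfun w * ((w 1 / w 0) ^ 2 + (w 2 / w 0) ^ 2 + (w 3 / w 0) ^ 2) ∧
      vv w 1 = 2 * βfun w * (w 1 / w 0) ∧
      vv w 2 = 2 * βfun w * (w 2 / w 0) ∧
      vv w 3 = 2 * βfun w * (w 3 / w 0) ∧
      vv w 4 = 2 * βfun w * w 4 ∧
      vv w 5 = 2 * βfun w * w 5 ∧
      vv w 6 = 2 * βfun w * w 6 ∧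
      vv w 7 = -2 * βfun w)
    (hφ : ∀ w, φ w = 2 * βfun w * ((w 1 * w 4 + w 2 * w 5 + w 3 * w 6) / w 0)) :
    ∀ w : Fin 8 → ℝ, 0 < w 0 → 0 < pfun w →
      ∀ h : Fin 8 → ℝ,
        fderiv ℝ F1 w h =
          (∑ i, vv w i * fderiv ℝ (fun z => f1 z i) w h)
            + φ w * fderiv ℝ (fun z : Fin 8 → ℝ => z 4) w h := by
  intro w hρ hpw h
  have hγ' : γ - 1 ≠ 0 := (sub_pos.2 hγ).ne'
  have hρ' := hρ.ne'
  have hp' := hpw.ne'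
  have c (i : Fin 8) : HasFDerivAt (fun z : Fin 8 → ℝ => z i)
      (ContinuousLinearMap.proj (R := ℝ) (φ := fun _ : Fin 8 => ℝ) i) w := hasFDerivAt_apply i w
  have u (i : Fin 8) := hasFDerivAt_div_real (c i) (c 0) hρ'
  have m (i j : Fin 8) := hasFDerivAt_div_real ((c i).fun_mul (c j)) (c 0) hρ'
  have c2 (i : Fin 8) := (c i).pow 2
  have q := (((c2 4).fun_add (c2 5)).fun_add
    (c2 6)).mul_const (2⁻¹ : ℝ)
  simp only [← div_eq_mul_inv] at q
  have k := hasFDerivAt_div_real (((c2 1).fun_add (c2 2)).fun_add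
    (c2 3)) ((c 0).const_mul 2) (mul_ne_zero two_ne_zero hρ')
  have p := (((c 7).fun_sub k).fun_sub q).const_mul (γ - 1)
  rw [← funext hp] at p
  have s := hasFDerivAt_log_mul_rpow_neg γ p (c 0) hpw hρ
  rw [← funext hs] at s
  have F := ((c 1).fun_mul s).fun_neg.mul_const (γ - 1)⁻¹
  simp only [← div_eq_mul_inv] at F
  rw [← funext hF1] at F
  have f₁ := ((m 1 1).fun_sub ((c 4).fun_mul (c 4))).fun_add (p.fun_add q)
  have f₂ := (m 1 2).fun_sub ((c 4).fun_mul (c 5))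
  have f₃ := (m 1 3).fun_sub ((c 4).fun_mul (c 6))
  have f₅ := ((u 1).fun_mul (c 5)).fun_sub ((c 4).fun_mul (u 2))
  have f₆ := ((u 1).fun_mul (c 6)).fun_sub ((c 4).fun_mul (u 3))
  have f₇ := ((((c 7).fun_add p).fun_add q).fun_mul (u 1)).fun_sub
    ((hasFDerivAt_div_real ((((c 1).fun_mul (c 4)).fun_add ((c 2).fun_mul (c 5))).fun_add
      ((c 3).fun_mul (c 6))) (c 0) hρ').fun_mul (c 4))
  obtain ⟨v0, v1, v2, v3, v4, v5, v6, v7⟩ := hv w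
  simp only [Fin.sum_univ_eight, hf1, v0, v1, v2, v3, v4, v5, v6, v7, hφ, hβ]
  rw [F.fderiv, f₁.fderiv, f₂.fderiv, f₃.fderiv, f₅.fderiv, f₆.fderiv, f₇.fderiv,
    (c 1).fderiv, (c 4).fderiv]
  have hE : w 7 = pfun w / (γ - 1) + (w 1 ^ 2 + w 2 ^ 2 + w 3 ^ 2) / (2 * w 0)
      + (w 4 ^ 2 + w 5 ^ 2 + w 6 ^ 2) / 2 := by
    rw [hp]; field_simp; ring
  simp [hE]
  field_simp
  ring
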